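/- Let $p$ be a prime, let $n\ge 3$, let $2\le k\le n-1$ and $\beta>1$, and let $\alpha$ be the composition of length $n-1$ with first part $2$, with $\beta$ in the $k$-th position, and all other parts $1$. Then: (1) if $\beta=2$, $g_\alpha(p)=p^{2n-k-4}+(n-k)p^{n-3}(p-1)$; (2) if $\beta\ge 3$, $g_\alpha(p)=(n-k)\left(p^{2n-k-4}+p^{n-3}(p-1)\right)$. -/

import Mathlib

/-- `A` is an irreducible subring matrix for the prime `p` with diagonal given by the
composition `α = (e₁, …, e_m)` (so `A` is `(m+1) × (m+1)`): `A` is upper triangular with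
diagonal `(p^{e₁}, …, p^{e_m}, 1)`, last column `(1, …, 1)ᵀ`, the above-diagonal entries
among the first `m` columns are divisible by `p` and lie in `[0, p^{eᵢ})`, and the
componentwise product of any two columns lies in the `ℤ`-span of the columns. -/
def IsIrrSubringMatrix (p : ℕ) {m : ℕ} (α : Fin m → ℕ)
    (A : Matrix (Fin (m + 1)) (Fin (m + 1)) ℤ) : Prop :=
  (∀ i j : Fin (m + 1), (j : ℕ) < (i : ℕ) → A i j = 0) ∧
  (∀ i : Fin m, A i.castSucc i.castSucc = (p : ℤ) ^ α i) ∧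
  (∀ i : Fin (m + 1), A i (Fin.last m) = 1) ∧
  (∀ i j : Fin m, (i : ℕ) < (j : ℕ) →
    (p : ℤ) ∣ A i.castSucc j.castSucc ∧ 0 ≤ A i.castSucc j.castSucc ∧
      A i.castSucc j.castSucc < (p : ℤ) ^ α i) ∧
  (∀ i j : Fin (m + 1), ∃ x : Fin (m + 1) → ℤ, A.mulVec x = fun r => A r i * A r j)

/-- `gMat p α` is the number of irreducible subring matrices with diagonal `α`. -/
noncomputable def gMat (p : ℕ) {m : ℕ} (α : Fin m → ℕ) : ℕ :=
  Nat.card {A : Matrix (Fin (m + 1)) (Fin (m + 1)) ℤ // IsIrrSubringMatrix p α A}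

/-- Adjoin a zero row and then a last column of ones to a square matrix. -/
def borderOnes {m : ℕ} (M : Matrix (Fin m) (Fin m) ℤ) :
    Matrix (Fin (m + 1)) (Fin (m + 1)) ℤ :=
  fun r c => Fin.lastCases (motive := fun _ => ℤ) 1
    (fun j => Fin.lastCases (motive := fun _ => ℤ) 0 (fun i => M i j) r) c

@[simp] lemma borderOnes_last {m : ℕ} (M : Matrix (Fin m) (Fin m) ℤ) (r : Fin (m + 1)) :
    borderOnes M r (Fin.last m) = 1 := by
  simp [borderOnes]

@[simp] lemma borderOnes_last_castSucc {m : ℕ} (M : Matrix (Fin m) (Fin m) ℤ) (j : Fin m) :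
    borderOnes M (Fin.last m) j.castSucc = 0 := by
  simp [borderOnes]

@[simp] lemma borderOnes_castSucc {m : ℕ} (M : Matrix (Fin m) (Fin m) ℤ) (i j : Fin m) :
    borderOnes M i.castSucc j.castSucc = M i j := by
  simp [borderOnes]

/-- The column span of a bordered matrix is closed under componentwise products as soon as the
products of the columns of the inner block lie in the span of these columns. -/
lemma borderOnes_mul_iff {m : ℕ} (M : Matrix (Fin m) (Fin m) ℤ) :
    (∀ i j : Fin (m + 1), ∃ x : Fin (m + 1) → ℤ,
      (borderOnes M).mulVec x = fun r => borderOnes M r i * borderOnes M r j) ↔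
    ∀ i j : Fin m, ∃ x : Fin m → ℤ, M.mulVec x = fun r => M r i * M r j := by
  constructor
  · intro h i j
    obtain ⟨x, hx⟩ := h i.castSucc j.castSucc
    have hl : x (Fin.last m) = 0 := by
      have := congrFun hx (Fin.last m)
      simpa [Matrix.mulVec, dotProduct, Fin.sum_univ_castSucc] using this
    refine ⟨fun l => x l.castSucc, ?_⟩
    ext r
    have := congrFun hx r.castSucc
    simpa [Matrix.mulVec, dotProduct, Fin.sum_univ_castSucc, hl] using this
  · intro h i j
    induction i using Fin.lastCases with
    | last => exact ⟨Pi.single j 1, by ext r; simp⟩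
    | cast i =>
      induction j using Fin.lastCases with
      | last => exact ⟨Pi.single i.castSucc 1, by ext r; simp⟩
      | cast j =>
        obtain ⟨x, hx⟩ := h i j
        refine ⟨Fin.snoc x 0, ?_⟩
        ext r
        induction r using Fin.lastCases with
        | last => simp [Matrix.mulVec, dotProduct, Fin.sum_univ_castSucc]
        | cast r =>
          have := congrFun hx r
          simpa [Matrix.mulVec, dotProduct, Fin.sum_univ_castSucc] using this

/-- The diagonal matrix with entries `d`, with `p * a` added to row `z` and `p * b` to row `K`. -/
def twoRowMat (p : ℕ) {m : ℕ} (d : Fin m → ℤ) (z K : Fin m) (a b : Fin m → ℤ) :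
    Matrix (Fin m) (Fin m) ℤ :=
  fun r j => (if r = j then d r else 0) + (if r = z then p * a j else 0) +
    (if r = K then p * b j else 0)

lemma twoRowMat_mul_iff {p m s : ℕ} (hp : 0 < p) {d a b : Fin m → ℤ} {z K : Fin m} (hzK : z ≠ K)
    (hz : d z = p ^ 2) (hK : d K = p ^ (s + 2)) (hd : ∀ i, i ≠ z → i ≠ K → d i = p)
    (haz : a z = 0) (hbz : b z = 0) (hbK : b K = 0) (i j : Fin m) :
    (∃ x : Fin m → ℤ, (twoRowMat p d z K a b).mulVec x =
      fun r => twoRowMat p d z K a b r i * twoRowMat p d z K a b r j) ↔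
    ∃ y : ℤ, p ^ s * y = b i * b j - (if i = j then b i else 0) ∧ (p : ℤ) ∣ a K * y := by
  have hp0 : (p : ℤ) ≠ 0 := by exact_mod_cast hp.ne'
  set M := twoRowMat p d z K a b with hM
  set c : ℤ := if i = j ∧ i ≠ z ∧ i ≠ K then p else 0 with hc
  set δ : ℤ := if i = K then 1 else 0 with hδ
  set ε : ℤ := if j = K then 1 else 0 with hε
  set δ' : ℤ := if i = z then 1 else 0 with hδ'
  set ε' : ℤ := if j = z then 1 else 0 with hε'
  have hMz : ∀ l, M z l = p ^ 2 * (if l = z then 1 else 0) + p * a l := by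
    intro l
    simp [hM, twoRowMat, hzK, hz, eq_comm]
  have hMK : ∀ l, M K l = p ^ (s + 2) * (if l = K then 1 else 0) + p * b l := by
    intro l
    simp [hM, twoRowMat, hzK.symm, hK, eq_comm]
  have hMr : ∀ r, r ≠ z → r ≠ K → ∀ l, M r l = if r = l then (p : ℤ) else 0 := by
    intro r h1 h2 l
    simp [hM, twoRowMat, h1, h2, hd r h1 h2]
  have hcb : c * b i = p * (if i = j then b i else 0) := by
    rw [hc]; split_ifs with h1 h2 <;> grind
  have hcz : c * (if i = z then 1 else 0) = 0 := by
    rw [hc]; split_ifs with h1 h2 <;> grind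
  have hcK : c * (if i = K then 1 else 0) = 0 := by
    rw [hc]; split_ifs with h1 h2 <;> grind
  have hpc : (p : ℤ) ∣ c := by
    rw [hc]; split_ifs <;> simp
  have key : ∀ X Y : ℤ, (M.mulVec (Pi.single z X + Pi.single K Y + Pi.single i c) =
      fun r => M r i * M r j) ↔
      (p ^ 2 * X + p * a K * Y + p * a i * c =
        (p ^ 2 * δ' + p * a i) * (p ^ 2 * ε' + p * a j) ∧
       p ^ (s + 2) * Y + p ^ 2 * (if i = j then b i else 0) =
        (p ^ (s + 2) * δ + p * b i) * (p ^ (s + 2) * ε + p * b j)) := by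
    intro X Y
    have e : ∀ r, M.mulVec (Pi.single z X + Pi.single K Y + Pi.single i c) r =
        M r z * X + M r K * Y + M r i * c := by
      intro r; simp [Matrix.mulVec_add]; ring
    constructor
    · intro h
      have h1 := congrFun h z
      have h2 := congrFun h K
      rw [e] at h1 h2
      simp only [hMz, hMK, hzK, hzK.symm, if_true, if_false, haz, hbz, hbK] at h1 h2
      constructor
      · linear_combination h1 - p ^ 2 * hcz
      · linear_combination h2 - p ^ (s + 2) * hcK - p * hcb
    · rintro ⟨h1, h2⟩
      ext r
      rw [e]
      by_cases hrz : r = z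
      · subst hrz
        simp only [hMz, hzK.symm, if_true, if_false, haz]
        linear_combination h1 + p ^ 2 * hcz
      · by_cases hrK : r = K
        · subst hrK
          simp only [hMK, hzK, if_true, if_false, hbz, hbK]
          linear_combination h2 + p ^ (s + 2) * hcK + p * hcb
        · simp only [hMr r hrz hrK]
          rw [hc]
          grind
  trans ∃ X Y : ℤ, M.mulVec (Pi.single z X + Pi.single K Y + Pi.single i c) =
      fun r => M r i * M r j
  · constructor
    · rintro ⟨x, hx⟩
      have hxr : ∀ r, r ≠ z → r ≠ K → x r = if r = i then c else 0 := by
        intro r h1 h2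
        have := congrFun hx r
        simp only [Matrix.mulVec, dotProduct, hMr r h1 h2, ite_mul, zero_mul,
          Finset.sum_ite_eq, Finset.mem_univ, if_true] at this
        have h3 : x r = if r = i ∧ r = j then (p : ℤ) else 0 := by
          apply mul_left_cancel₀ hp0
          rw [this]
          grind
        rw [h3, hc]
        grind
      refine ⟨x z, x K, ?_⟩
      rw [← hx]
      congr 1
      ext r
      simp only [Pi.add_apply, Pi.single_apply]
      grind
    · rintro ⟨X, Y, h⟩
      exact ⟨_, h⟩
  simp only [key]
  constructor
  · rintro ⟨X, Y, h1, h2⟩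
    refine ⟨Y - (p ^ (s + 2) * δ * ε + p * b j * δ + p * b i * ε), ?_, ?_⟩
    · apply mul_left_cancel₀ (pow_ne_zero 2 hp0)
      linear_combination h2
    · obtain ⟨c', hc'⟩ := hpc
      have : a K * Y = p * ((p * δ' + a i) * (p * ε' + a j) - X - a i * c') := by
        apply mul_left_cancel₀ hp0
        linear_combination h1 - p * a i * hc'
      rw [mul_sub, this]
      exact ⟨((p * δ' + a i) * (p * ε' + a j) - X - a i * c') -
        a K * (p ^ (s + 1) * δ * ε + b j * δ + b i * ε), by ring⟩
  · rintro ⟨y, h1, t, ht⟩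
    obtain ⟨c', hc'⟩ := hpc
    refine ⟨(p * δ' + a i) * (p * ε' + a j) - a i * c' - t -
      a K * (p ^ (s + 1) * δ * ε + b j * δ + b i * ε),
      y + (p ^ (s + 2) * δ * ε + p * b j * δ + p * b i * ε), ?_, ?_⟩
    · linear_combination p * ht + p * a i * hc'
    · linear_combination p ^ 2 * h1

/-- A matrix with diagonal `(p², 1, …, p ^ (s + 2), …)` is an irreducible subring matrix exactly
when its nontrivial rows satisfy an orthogonal-idempotent congruence. -/
lemma isIrrSubringMatrix_iff {p m s : ℕ} (hp : 0 < p) {α : Fin m → ℕ} {z K : Fin m}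
    (hz0 : (z : ℕ) = 0) (hzK : z ≠ K) (hz : α z = 2) (hK : α K = s + 2)
    (h1 : ∀ i, i ≠ z → i ≠ K → α i = 1) (A : Matrix (Fin (m + 1)) (Fin (m + 1)) ℤ) :
    IsIrrSubringMatrix p α A ↔ ∃ a b : Fin m → ℤ,
      (a z = 0 ∧ ∀ j, 0 ≤ a j ∧ a j < p) ∧
      ((∀ j, ¬ K < j → b j = 0) ∧ ∀ j, 0 ≤ b j ∧ b j < p * p ^ s) ∧
      (∀ i j, ∃ y : ℤ, p ^ s * y = b i * b j - (if i = j then b i else 0) ∧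
        (p : ℤ) ∣ a K * y) ∧
      A = borderOnes (twoRowMat p (fun i => (p : ℤ) ^ α i) z K a b) := by
  have hp0 : (0 : ℤ) < p := by exact_mod_cast hp
  have hzlt : ∀ j, j ≠ z → z < j := by
    intro j hj
    have : (j : ℕ) ≠ z := fun h => hj (Fin.ext h)
    rw [Fin.lt_def]; omega
  have hzltK := hzlt K hzK.symm
  have hmul : ∀ a b : Fin m → ℤ, a z = 0 → (∀ j, ¬ K < j → b j = 0) →
      ((∀ i j : Fin (m + 1), ∃ x : Fin (m + 1) → ℤ,
        (borderOnes (twoRowMat p (fun i => (p : ℤ) ^ α i) z K a b)).mulVec x = fun r =>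
          borderOnes (twoRowMat p (fun i => (p : ℤ) ^ α i) z K a b) r i *
          borderOnes (twoRowMat p (fun i => (p : ℤ) ^ α i) z K a b) r j) ↔
      ∀ i j, ∃ y : ℤ, p ^ s * y = b i * b j - (if i = j then b i else 0) ∧
        (p : ℤ) ∣ a K * y) := by
    intro a b ha hb
    rw [borderOnes_mul_iff]
    refine forall_congr' fun i => forall_congr' fun j => ?_
    exact twoRowMat_mul_iff hp hzK (by simp [hz]) (by simp [hK])
      (fun i h h' => by simp [h1 i h h']) ha (hb _ hzltK.not_gt) (hb _ (lt_irrefl _)) i j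
  constructor
  · rintro ⟨hA1, hA2, hA3, hA4, hA5⟩
    let a : Fin m → ℤ := fun j => if z < j then A z.castSucc j.castSucc / p else 0
    let b : Fin m → ℤ := fun j => if K < j then A K.castSucc j.castSucc / p else 0
    have haz : a z = 0 := by simp [a]
    have hbK : ∀ j, ¬ K < j → b j = 0 := by intro j hj; simp [b, hj]
    have hA : A = borderOnes (twoRowMat p (fun i => (p : ℤ) ^ α i) z K a b) := by
      ext r c
      induction c using Fin.lastCases with
      | last => simp [hA3]
      | cast c =>
        induction r using Fin.lastCases with
        | last => simpa using hA1 (Fin.last m) c.castSucc (by simp)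
        | cast r =>
          rw [borderOnes_castSucc]
          rcases lt_trichotomy r c with h | h | h
          · obtain ⟨⟨t, ht⟩, h2, h3⟩ := hA4 r c h
            by_cases hrz : r = z
            · subst hrz
              simp [twoRowMat, hzK, h.ne, a, h, ht, Int.mul_ediv_cancel_left t hp0.ne']
            · by_cases hrK : r = K
              · subst hrK
                simp [twoRowMat, hzK.symm, h.ne, b, h, ht, Int.mul_ediv_cancel_left t hp0.ne']
              · simp only [twoRowMat, h.ne, hrz, hrK, if_false]
                rw [h1 r hrz hrK, pow_one] at h3
                rw [Int.eq_zero_of_dvd_of_nonneg_of_lt h2 h3 ⟨t, ht⟩]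
                simp
          · subst h
            rw [hA2]
            have e1 : r = z → a r = 0 := by rintro rfl; exact haz
            have e2 : r = K → b r = 0 := by rintro rfl; exact hbK _ (lt_irrefl _)
            simp only [twoRowMat, if_true]
            split_ifs <;> simp_all
          · rw [hA1 _ _ (by simpa using h)]
            have e1 : r ≠ z := by
              rintro rfl
              have := Fin.lt_def.1 h
              omega
            have e2 : r = K → b c = 0 := by rintro rfl; exact hbK _ h.not_gt
            simp only [twoRowMat, h.ne', e1, if_false]
            split_ifs <;> simp_all
    refine ⟨a, b, ⟨haz, ?_⟩, ⟨hbK, ?_⟩, ?_, hA⟩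
    · intro j
      by_cases h : z < j
      · obtain ⟨⟨t, ht⟩, h2, h3⟩ := hA4 z j h
        simp only [a, h, if_true]
        refine ⟨Int.ediv_nonneg h2 hp0.le, ?_⟩
        rw [hz] at h3
        apply Int.ediv_lt_of_lt_mul hp0
        linarith
      · simp [a, h, hp]
    · intro j
      by_cases h : K < j
      · obtain ⟨⟨t, ht⟩, h2, h3⟩ := hA4 K j h
        simp only [b, h, if_true]
        refine ⟨Int.ediv_nonneg h2 hp0.le, ?_⟩
        rw [hK] at h3
        apply Int.ediv_lt_of_lt_mul hp0
        calc _ < _ := h3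
          _ = _ := by ring
      · simp only [b, h, if_false]
        exact ⟨le_rfl, by positivity⟩
    · rw [hA] at hA5
      exact (hmul a b haz hbK).1 hA5
  · rintro ⟨a, b, ⟨haz, ha⟩, ⟨hbK, hb⟩, hy, rfl⟩
    refine ⟨?_, ?_, by simp, ?_, (hmul a b haz hbK).2 hy⟩
    · intro r c h
      induction c using Fin.lastCases with
      | last =>
        have := r.2
        simp only [Fin.val_last] at h
        omega
      | cast c =>
        induction r using Fin.lastCases with
        | last => simp
        | cast r =>
          rw [borderOnes_castSucc]
          have h : c < r := h
          have e1 : r ≠ z := by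
            rintro rfl
            have := Fin.lt_def.1 h
            omega
          have e2 : r = K → b c = 0 := by rintro rfl; exact hbK _ h.not_gt
          simp only [twoRowMat, h.ne', e1, if_false]
          split_ifs <;> simp_all
    · intro r
      have e1 : r = z → a r = 0 := by rintro rfl; exact haz
      have e2 : r = K → b r = 0 := by rintro rfl; exact hbK _ (lt_irrefl _)
      simp only [borderOnes_castSucc, twoRowMat, if_true]
      split_ifs <;> simp_all
    · intro r c h
      have h : r < c := h
      simp only [borderOnes_castSucc, twoRowMat, h.ne, if_false, zero_add]
      by_cases hrz : r = z
      · subst hrz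
        simp only [if_true, hzK, if_false, add_zero, hz]
        exact ⟨dvd_mul_right _ _, mul_nonneg hp0.le (ha c).1, by
          rw [pow_two]; exact mul_lt_mul_of_pos_left (ha c).2 hp0⟩
      · by_cases hrK : r = K
        · subst hrK
          simp only [if_true, hzK.symm, if_false, zero_add, hK]
          exact ⟨dvd_mul_right _ _, mul_nonneg hp0.le (hb c).1, by
            have := mul_lt_mul_of_pos_left (hb c).2 hp0
            calc _ < _ := this
              _ = _ := by ring⟩
        · simp [hrz, hrK, hp]

/-- The family `b` consists of pairwise orthogonal idempotents modulo `q`. -/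
def IsOrthIdem {ι : Type*} [DecidableEq ι] (q : ℤ) (b : ι → ℤ) : Prop :=
  ∀ i j, q ∣ b i * b j - (if i = j then b i else 0)

/-- The residues of `b` modulo `p ^ s` are orthogonal idempotents, and the quotients witnessing
this are annihilated by `x` modulo `p`. -/
def IsOrthIdemWith {ι : Type*} [DecidableEq ι] (p s : ℕ) (x : ℤ) (b : ι → ℤ) : Prop :=
  ∀ i j, ∃ y : ℤ, p ^ s * y = b i * b j - (if i = j then b i else 0) ∧ (p : ℤ) ∣ x * y

lemma isOrthIdemWith_of_dvd {ι : Type*} [DecidableEq ι] {p s : ℕ} {x : ℤ} (hx : (p : ℤ) ∣ x)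
    (b : ι → ℤ) : IsOrthIdemWith p s x b ↔ IsOrthIdem ((p ^ s : ℕ) : ℤ) b := by
  refine forall_congr' fun i => forall_congr' fun j => ?_
  push_cast
  exact ⟨fun ⟨y, hy, _⟩ => ⟨y, hy.symm⟩, fun ⟨y, hy⟩ => ⟨y, hy.symm, hx.mul_right y⟩⟩

lemma isOrthIdemWith_of_not_dvd {ι : Type*} [DecidableEq ι] {p s : ℕ} (hp : p.Prime) {x : ℤ}
    (hx : ¬ (p : ℤ) ∣ x) (b : ι → ℤ) :
    IsOrthIdemWith p s x b ↔ IsOrthIdem ((p ^ (s + 1) : ℕ) : ℤ) b := by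
  refine forall_congr' fun i => forall_congr' fun j => ?_
  push_cast
  constructor
  · rintro ⟨y, hy, h⟩
    obtain ⟨t, rfl⟩ := ((Nat.prime_iff_prime_int.1 hp).dvd_or_dvd h).resolve_left hx
    exact ⟨t, by rw [← hy]; ring⟩
  · rintro ⟨t, ht⟩
    exact ⟨p * t, by rw [ht]; ring, ⟨x * t, by ring⟩⟩

lemma card_isOrthIdem_prime_pow {ι : Type*} [DecidableEq ι] [Fintype ι] {p u : ℕ} (hp : p.Prime)
    (hu : u ≠ 0) :
    Nat.card {b : ι → Fin (p ^ u) // IsOrthIdem ((p ^ u : ℕ) : ℤ) (fun i => ((b i : ℕ) : ℤ))} =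
      Fintype.card ι + 1 := by
  have hq : 1 < p ^ u := Nat.one_lt_pow hu hp.one_lt
  have hp' := Nat.prime_iff_prime_int.1 hp
  rw [← Fintype.card_option, ← Nat.card_eq_fintype_card]
  symm
  let e : Option ι → ι → Fin (p ^ u) := fun o i =>
    if o = some i then ⟨1, hq⟩ else ⟨0, by omega⟩
  have he : ∀ o i, ((e o i : ℕ) : ℤ) = if o = some i then 1 else 0 := by
    intro o i
    simp only [e]
    split_ifs <;> rfl
  refine Nat.card_congr (Equiv.ofBijective (fun o => ⟨e o, ?_⟩) ⟨?_, ?_⟩)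
  · intro i j
    have h0 : (if o = some i then 1 else 0 : ℤ) * (if o = some j then 1 else 0) -
        (if i = j then (if o = some i then 1 else 0) else 0) = 0 := by
      grind
    simp only [he, h0, dvd_zero]
  · intro o o' h
    have h' : ∀ i, (if o = some i then 1 else 0 : ℤ) = if o' = some i then 1 else 0 := by
      intro i
      have h2 : e o i = e o' i := congrFun (congrArg Subtype.val h) i
      rw [← he, ← he, h2]
    ext i
    have := h' i
    grind
  · rintro ⟨b, hb⟩
    have h01 : ∀ i, (b i : ℕ) = 0 ∨ (b i : ℕ) = 1 := by
      intro i
      have h := hb i i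
      simp only [if_true] at h
      have h : (p : ℤ) ^ u ∣ (b i : ℕ) * ((b i : ℕ) - 1 : ℤ) := by
        have h2 : ((b i : ℕ) * ((b i : ℕ) - 1) : ℤ) = (b i : ℕ) * (b i : ℕ) - (b i : ℕ) := by ring
        rw [h2]
        exact_mod_cast h
      have hlt : ((b i : ℕ) : ℤ) < (p : ℤ) ^ u := by exact_mod_cast (b i).2
      by_cases hpb : (p : ℤ) ∣ (b i : ℕ)
      · left
        have hn : ¬ (p : ℤ) ∣ ((b i : ℕ) - 1 : ℤ) := fun h3 =>
          hp'.not_dvd_one (by simpa using dvd_sub hpb h3)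
        have := Int.eq_zero_of_dvd_of_nonneg_of_lt (by positivity) hlt
          (hp'.pow_dvd_of_dvd_mul_right u hn h)
        exact_mod_cast this
      · right
        have h4 := hp'.pow_dvd_of_dvd_mul_left u hpb h
        by_cases h0 : (b i : ℕ) = 0
        · exact absurd (by simp [h0]) hpb
        · have := Int.eq_zero_of_dvd_of_nonneg_of_lt (by omega) (by omega) h4
          omega
    have hone : ∀ i j, (b i : ℕ) = 1 → (b j : ℕ) = 1 → i = j := by
      intro i j hi hj
      by_contra hij
      have h := hb i j
      simp only [hi, hj, hij, if_false] at h
      have := Int.le_of_dvd (by norm_num) h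
      have : ((1 : ℕ) : ℤ) < (p ^ u : ℕ) := by exact_mod_cast hq
      simp_all
      omega
    by_cases hex : ∃ i, (b i : ℕ) = 1
    · obtain ⟨i, hi⟩ := hex
      refine ⟨some i, Subtype.ext (funext fun j => Fin.ext ?_)⟩
      zify
      simp only [he, Option.some.injEq]
      have := h01 j
      have := hone i j hi
      grind
    · refine ⟨none, Subtype.ext (funext fun j => Fin.ext ?_)⟩
      zify
      simp only [he]
      have := h01 j
      grind

lemma isOrthIdem_congr {ι : Type*} [DecidableEq ι] {q : ℤ} {b b' : ι → ℤ}
    (h : ∀ i, b i ≡ b' i [ZMOD q]) : IsOrthIdem q b ↔ IsOrthIdem q b' := by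
  refine forall_congr' fun i => forall_congr' fun j => ?_
  refine Int.ModEq.dvd_iff ?_
  refine ((h i).mul (h j)).sub ?_
  split_ifs
  exacts [h i, rfl]

lemma card_isOrthIdem_mul {ι : Type*} [DecidableEq ι] [Fintype ι] (t q : ℕ) :
    Nat.card {b : ι → Fin (t * q) // IsOrthIdem (q : ℤ) (fun i => ((b i : ℕ) : ℤ))} =
      t ^ Fintype.card ι *
        Nat.card {b : ι → Fin q // IsOrthIdem (q : ℤ) (fun i => ((b i : ℕ) : ℤ))} := by
  have : Nat.card (ι → Fin t) = t ^ Fintype.card ι := by simp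
  rw [← this, ← Nat.card_prod]
  symm
  let e : (ι → Fin t) × (ι → Fin q) ≃ (ι → Fin (t * q)) :=
    (Equiv.arrowProdEquivProdArrow ι (fun _ => Fin t) (fun _ => Fin q)).symm.trans
      (Equiv.arrowCongr (Equiv.refl ι) finProdFinEquiv)
  have h : ∀ x : (ι → Fin t) × (ι → Fin q),
      IsOrthIdem (q : ℤ) (fun i => ((x.2 i : ℕ) : ℤ)) ↔
        IsOrthIdem (q : ℤ) (fun i => ((e x i : ℕ) : ℤ)) := by
    intro x
    refine isOrthIdem_congr fun i => ?_
    have : (e x i : ℕ) = x.2 i + q * x.1 i := rfl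
    rw [this]
    push_cast
    simp [Int.ModEq]
  refine Nat.card_congr (Equiv.trans ?_ (e.subtypeEquiv h))
  exact {
    toFun := fun x => ⟨(x.1, x.2.1), x.2.2⟩
    invFun := fun x => (x.1.1, ⟨x.1.2, x.2⟩)
    left_inv := fun _ => rfl
    right_inv := fun _ => rfl }

lemma sum_card_isOrthIdemWith {ι : Type*} [DecidableEq ι] [Fintype ι] {p s : ℕ} (hp : p.Prime) :
    ∑ x : Fin p, Nat.card {b : ι → Fin (p * p ^ s) //
        IsOrthIdemWith p s (x : ℕ) (fun i => ((b i : ℕ) : ℤ))} =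
      p ^ Fintype.card ι * (if s = 0 then 1 else Fintype.card ι + 1) +
        (p - 1) * (Fintype.card ι + 1) := by
  have : NeZero p := ⟨hp.ne_zero⟩
  rw [← Finset.add_sum_erase _ _ (Finset.mem_univ (0 : Fin p))]
  congr 1
  · simp only [isOrthIdemWith_of_dvd (p := p) (x := (((0 : Fin p) : ℕ) : ℤ)) (by simp)]
    rw [card_isOrthIdem_mul]
    congr 1
    split_ifs with hs
    · subst hs
      have : ∀ b : ι → Fin (p ^ 0), IsOrthIdem ((p ^ 0 : ℕ) : ℤ) (fun i => ((b i : ℕ) : ℤ)) :=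
        fun b i j => by simp
      rw [Nat.card_congr (Equiv.subtypeUnivEquiv this)]
      simp
    · exact card_isOrthIdem_prime_pow hp hs
  · rw [Finset.sum_congr rfl (g := fun _ => Fintype.card ι + 1)]
    · simp
    · intro x hx
      have hx0 : (x : ℕ) ≠ 0 := fun h => Finset.ne_of_mem_erase hx (Fin.ext h)
      have hnd : ¬ (p : ℤ) ∣ ((x : ℕ) : ℤ) := by
        intro h
        have := Nat.le_of_dvd (by omega) (Int.natCast_dvd_natCast.1 h)
        have := x.2
        omega
      simp only [isOrthIdemWith_of_not_dvd hp hnd]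
      rw [← pow_succ']
      exact card_isOrthIdem_prime_pow hp (by omega)

lemma gMat_eq {p m s : ℕ} (hp : p.Prime) {α : Fin m → ℕ} {z K : Fin m}
    (hz0 : (z : ℕ) = 0) (hzK : z ≠ K) (hz : α z = 2) (hK : α K = s + 2)
    (h1 : ∀ i, i ≠ z → i ≠ K → α i = 1) :
    gMat p α = p ^ (m - 2) * (p ^ (m - 1 - K) * (if s = 0 then 1 else m - K) +
      (p - 1) * (m - K)) := by
  have hcU : Fintype.card {j : Fin m // j ≠ z ∧ j ≠ K} = m - 2 := by
    rw [Fintype.card_subtype]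
    have : (Finset.univ.filter fun j : Fin m => j ≠ z ∧ j ≠ K) = {z, K}ᶜ := by
      ext j; simp
    rw [this, Finset.card_compl, Finset.card_pair hzK, Fintype.card_fin]
  have hcB : Fintype.card {j : Fin m // K < j} = m - 1 - K := by
    rw [Fintype.card_subtype]
    have : (Finset.univ.filter fun j : Fin m => K < j) = Finset.Ioi K := by
      ext j; simp
    rw [this, Fin.card_Ioi]
  let P := ({j : Fin m // j ≠ z ∧ j ≠ K} → Fin p) × Σ x : Fin p,
    {b : {j : Fin m // K < j} → Fin (p * p ^ s) //
      IsOrthIdemWith p s (x : ℕ) (fun i => ((b i : ℕ) : ℤ))}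
  have hP : Nat.card P = p ^ (m - 2) * (p ^ (m - 1 - K) * (if s = 0 then 1 else m - K) +
      (p - 1) * (m - K)) := by
    have hKm := K.2
    simp only [P]
    rw [Nat.card_prod, Nat.card_sigma, sum_card_isOrthIdemWith hp, Nat.card_fun,
      Nat.card_eq_fintype_card, Nat.card_eq_fintype_card, hcU, hcB, Fintype.card_fin,
      show m - 1 - K + 1 = m - K by omega]
  rw [← hP, gMat]
  symm
  let a : P → Fin m → ℤ := fun t j =>
    if h : j ≠ z ∧ j ≠ K then ((t.1 ⟨j, h⟩ : ℕ) : ℤ) else if j = K then ((t.2.1 : ℕ) : ℤ) else 0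
  let b : P → Fin m → ℤ := fun t j => if h : K < j then ((t.2.2.1 ⟨j, h⟩ : ℕ) : ℤ) else 0
  have haK : ∀ t, a t K = ((t.2.1 : ℕ) : ℤ) := by intro t; simp [a]
  have haU : ∀ t (j : {j : Fin m // j ≠ z ∧ j ≠ K}), a t j = ((t.1 j : ℕ) : ℤ) := by
    intro t j; simp [a, j.2]
  have hbB : ∀ t (j : {j : Fin m // K < j}), b t j = ((t.2.2.1 j : ℕ) : ℤ) := by
    intro t j; simp [b, j.2]
  have hlow : ∀ j, j ≠ z → z < j := by
    intro j hj
    have : (j : ℕ) ≠ z := fun h => hj (Fin.ext h)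
    rw [Fin.lt_def]; omega
  let d : Fin m → ℤ := fun i => (p : ℤ) ^ α i
  let f : P → {A // IsIrrSubringMatrix p α A} := fun t =>
    ⟨borderOnes (twoRowMat p d z K (a t) (b t)), by
      rw [isIrrSubringMatrix_iff hp.pos hz0 hzK hz hK h1]
      refine ⟨a t, b t, ⟨?_, ?_⟩, ⟨?_, ?_⟩, ?_, rfl⟩
      · simp [a, hzK]
      · intro j
        simp only [a]
        have := hp.pos
        split_ifs <;> constructor <;> first | positivity | simp
      · intro j hj
        simp [b, hj]
      · intro j
        simp only [b]
        have : 0 < p * p ^ s := mul_pos hp.pos (pow_pos hp.pos _)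
        split_ifs
        · exact ⟨by positivity, by exact_mod_cast (t.2.2.1 _).2⟩
        · exact ⟨le_rfl, by exact_mod_cast this⟩
      · intro i j
        by_cases h : K < i ∧ K < j
        · obtain ⟨y, hy, hy'⟩ := t.2.2.2 ⟨i, h.1⟩ ⟨j, h.2⟩
          refine ⟨y, ?_, by rwa [haK]⟩
          simpa [b, h] using hy
        · refine ⟨0, ?_, by simp⟩
          simp only [b]
          grind⟩
  refine Nat.card_congr (Equiv.ofBijective f ⟨?_, ?_⟩)
  · intro t t' h
    have hM : ∀ r c, twoRowMat p d z K (a t) (b t) r c = twoRowMat p d z K (a t') (b t') r c := by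
      intro r c
      have := congrFun (congrFun (congrArg Subtype.val h) r.castSucc) c.castSucc
      simpa [f] using this
    have ha : ∀ j, a t j = a t' j := by
      intro j
      simpa [twoRowMat, hzK, hp.ne_zero] using hM z j
    have hb : ∀ j, b t j = b t' j := by
      intro j
      simpa [twoRowMat, hzK.symm, hp.ne_zero] using hM K j
    obtain ⟨t1, t2, t3, t4⟩ := t
    obtain ⟨t1', t2', t3', t4'⟩ := t'
    have e1 : t1 = t1' := by
      ext j
      have := ha j
      rw [haU, haU] at this
      exact_mod_cast this
    have e2 : t2 = t2' := by
      ext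
      have := ha K
      rw [haK, haK] at this
      exact_mod_cast this
    have e3 : t3 = t3' := by
      ext j
      have := hb j
      rw [hbB, hbB] at this
      exact_mod_cast this
    subst e1 e2 e3
    rfl
  · rintro ⟨A, hA⟩
    obtain ⟨a', b', ⟨ha1, ha2⟩, ⟨hb1, hb2⟩, hy, rfl⟩ :=
      (isIrrSubringMatrix_iff hp.pos hz0 hzK hz hK h1 A).1 hA
    have hva : ∀ j, ((a' j).toNat : ℤ) = a' j := fun j => Int.toNat_of_nonneg (ha2 j).1
    have hvb : ∀ j, ((b' j).toNat : ℤ) = b' j := fun j => Int.toNat_of_nonneg (hb2 j).1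
    have hla : ∀ j, (a' j).toNat < p := fun j => by
      have := (ha2 j).2
      rw [← hva] at this
      exact_mod_cast this
    have hlb : ∀ j, (b' j).toNat < p * p ^ s := fun j => by
      have := (hb2 j).2
      rw [← hvb] at this
      exact_mod_cast this
    let t : P := ⟨fun j => ⟨(a' j).toNat, hla j⟩, ⟨(a' K).toNat, hla K⟩,
      fun j => ⟨(b' j).toNat, hlb j⟩, by
        intro i j
        obtain ⟨y, h, h'⟩ := hy i j
        refine ⟨y, ?_, by simpa only [hva] using h'⟩
        simpa only [hvb, Subtype.ext_iff] using h⟩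
    refine ⟨t, Subtype.ext ?_⟩
    have e1 : a t = a' := by
      ext j
      simp only [a, t, hva]
      grind
    have e2 : b t = b' := by
      ext j
      simp only [b, t, hvb]
      grind
    simp only [f, e1, e2, d]

/-- For a prime `p`, `n ≥ 3`, `2 ≤ k ≤ n-1` and `β > 1`, let `α` be the composition of
length `n-1` with first part `2`, with `β` in the `k`-th position, and all other parts `1`.
Then `g_α(p) = p^{2n-k-4} + (n-k)p^{n-3}(p-1)` if `β = 2`, and
`g_α(p) = (n-k)(p^{2n-k-4} + p^{n-3}(p-1))` if `β ≥ 3`. -/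
theorem gMat_two_beta (p : ℕ) (hp : p.Prime) (n k β : ℕ) (hn : 3 ≤ n)
    (hk2 : 2 ≤ k) (hkn : k ≤ n - 1) (hβ : 1 < β) :
    (β = 2 →
      gMat p (fun i : Fin (n - 1) =>
          if (i : ℕ) = 0 then 2 else if (i : ℕ) + 1 = k then β else 1) =
        p ^ (2 * n - k - 4) + (n - k) * p ^ (n - 3) * (p - 1)) ∧
    (3 ≤ β →
      gMat p (fun i : Fin (n - 1) =>
          if (i : ℕ) = 0 then 2 else if (i : ℕ) + 1 = k then β else 1) =
        (n - k) * (p ^ (2 * n - k - 4) + p ^ (n - 3) * (p - 1))) := by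
  obtain ⟨s, rfl⟩ : ∃ s, β = s + 2 := ⟨β - 2, by omega⟩
  have h := gMat_eq (s := s) hp
    (α := fun i : Fin (n - 1) =>
      if (i : ℕ) = 0 then 2 else if (i : ℕ) + 1 = k then s + 2 else 1)
    (z := ⟨0, by omega⟩) (K := ⟨k - 1, by omega⟩) rfl
    (by simp only [ne_eq, Fin.mk.injEq]; omega) (by simp)
    (by
      simp only
      rw [if_neg (by omega), if_pos (by omega)])
    (by
      intro i hi hi'
      have h1 : (i : ℕ) ≠ 0 := fun h => hi (Fin.ext h)
      have h2 : (i : ℕ) ≠ k - 1 := fun h => hi' (Fin.ext h)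
      rw [if_neg h1, if_neg (by omega)])
  rw [h]
  simp only
  rw [show n - 1 - 2 = n - 3 by omega, show n - 1 - (k - 1) = n - k by omega,
    show n - 1 - 1 - (k - 1) = n - 1 - k by omega,
    show 2 * n - k - 4 = (n - 3) + (n - 1 - k) by omega, pow_add]
  constructor
  · intro hs
    rw [if_pos (by omega)]
    ring
  · intro hs
    rw [if_neg (by omega)]
    ring
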